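/- Let H be a cocommutative weak Hopf algebra over a commutative ring k and A a unital associative k-algebra. If (φ_A, α) and (ϕ_A, β) are equivalent crossed systems for H over A, realized by h ∈ Reg_{φ_A}(H,A)∩Reg_{ϕ_A}(H,A), then the associated H-cleft extensions A ↪ A×_αH and A ↪ A×_βH are equivalent; explicitly, T = p_{A⊗H}∘(μ_A⊗H)∘(A⊗h⊗H)∘(A⊗δ_H)∘i_{A⊗H}: A×_αH → A×_βH is an isomorphism of right H-comodule algebras with T∘i_{A×_αH} = i_{A×_βH}. -/

import Mathlib

open TensorProduct

noncomputable section

namespace WHA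

variable (k : Type) [CommRing k]

/-- Generalized convolution product of two linear maps from a "coalgebra"
(given by a comultiplication `δC`) to a module `P` with a product `m`. -/
def convG {C P : Type} [AddCommGroup C] [Module k C] [AddCommGroup P] [Module k P]
    (δC : C →ₗ[k] C ⊗[k] C) (m : P ⊗[k] P →ₗ[k] P) (f g : C →ₗ[k] P) : C →ₗ[k] P :=
  m ∘ₗ TensorProduct.map f g ∘ₗ δC

/-- Convolution product of two linear maps from a "coalgebra" to an algebra. -/
def conv {C A : Type} [AddCommGroup C] [Module k C] [Ring A] [Algebra k A]
    (δC : C →ₗ[k] C ⊗[k] C) (f g : C →ₗ[k] A) : C →ₗ[k] A :=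
  convG k δC (LinearMap.mul' k A) f g

variable (H : Type) [Ring H] [Algebra k H]

/-- The structure maps (comultiplication, counit, antipode) of a prospective
weak Hopf algebra on the `k`-algebra `H`. -/
structure HopfData where
  δ : H →ₗ[k] H ⊗[k] H
  ε : H →ₗ[k] k
  lam : H →ₗ[k] H

variable {k H}

/-- The target map `Π^L_H = ((ε∘μ)⊗H)∘(H⊗c)∘((δ∘η)⊗H)`. -/
def PiL (W : HopfData k H) : H →ₗ[k] H :=
  (TensorProduct.rid k H).toLinearMap
    ∘ₗ LinearMap.lTensor H (W.ε ∘ₗ LinearMap.mul' k H)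
    ∘ₗ (TensorProduct.assoc k H H H).toLinearMap
    ∘ₗ LinearMap.rTensor H (TensorProduct.comm k H H).toLinearMap
    ∘ₗ TensorProduct.mk k (H ⊗[k] H) H (W.δ 1)

/-- The source map `Π^R_H = (H⊗(ε∘μ))∘(c⊗H)∘(H⊗(δ∘η))`. -/
def PiR (W : HopfData k H) : H →ₗ[k] H :=
  (TensorProduct.lid k H).toLinearMap
    ∘ₗ LinearMap.rTensor H (W.ε ∘ₗ LinearMap.mul' k H)
    ∘ₗ (TensorProduct.assoc k H H H).symm.toLinearMap
    ∘ₗ LinearMap.lTensor H (TensorProduct.comm k H H).toLinearMap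
    ∘ₗ (TensorProduct.mk k H (H ⊗[k] H)).flip (W.δ 1)

/-- `H` together with the data `W` is a weak Hopf algebra. -/
structure IsWeakHopf (W : HopfData k H) : Prop where
  coassoc : ∀ h : H,
    (TensorProduct.assoc k H H H) ((LinearMap.rTensor H W.δ) (W.δ h)) =
      (LinearMap.lTensor H W.δ) (W.δ h)
  counit_left : ∀ h : H, (TensorProduct.lid k H) ((LinearMap.rTensor H W.ε) (W.δ h)) = h
  counit_right : ∀ h : H, (TensorProduct.rid k H) ((LinearMap.lTensor H W.ε) (W.δ h)) = h
  a1 : ∀ x y : H, W.δ (x * y) = W.δ x * W.δ y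
  a2 : ∀ x y z : H, W.ε (x * y * z) =
    LinearMap.mul' k k ((TensorProduct.map (W.ε ∘ₗ LinearMap.mulLeft k x)
      (W.ε ∘ₗ LinearMap.mulRight k z)) (W.δ y))
  a2' : ∀ x y z : H, W.ε (x * y * z) =
    LinearMap.mul' k k ((TensorProduct.map (W.ε ∘ₗ LinearMap.mulLeft k x)
      (W.ε ∘ₗ LinearMap.mulRight k z)) ((TensorProduct.comm k H H) (W.δ y)))
  a3 : (TensorProduct.assoc k H H H) ((LinearMap.rTensor H W.δ) (W.δ 1)) =
    (TensorProduct.map LinearMap.id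
        (Algebra.TensorProduct.includeLeft : H →ₐ[k] H ⊗[k] H).toLinearMap) (W.δ 1) *
      (Algebra.TensorProduct.includeRight : (H ⊗[k] H) →ₐ[k] H ⊗[k] (H ⊗[k] H)).toLinearMap
        (W.δ 1)
  a3' : (TensorProduct.assoc k H H H) ((LinearMap.rTensor H W.δ) (W.δ 1)) =
    (Algebra.TensorProduct.includeRight : (H ⊗[k] H) →ₐ[k] H ⊗[k] (H ⊗[k] H)).toLinearMap
        (W.δ 1) *
      (TensorProduct.map LinearMap.id
        (Algebra.TensorProduct.includeLeft : H →ₐ[k] H ⊗[k] H).toLinearMap) (W.δ 1)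
  a4_left : ∀ h : H,
    LinearMap.mul' k H ((TensorProduct.map LinearMap.id W.lam) (W.δ h)) = PiL W h
  a4_right : ∀ h : H,
    LinearMap.mul' k H ((TensorProduct.map W.lam LinearMap.id) (W.δ h)) = PiR W h
  a4_mid : conv k W.δ (conv k W.δ W.lam LinearMap.id) W.lam = W.lam

/-- `H` is cocommutative. -/
def Cocomm (W : HopfData k H) : Prop :=
  ∀ h : H, (TensorProduct.comm k H H) (W.δ h) = W.δ h

section ComodAlg

variable {A : Type} [Ring A] [Algebra k A]

/-- The map `ζ_A = (μ_A⊗H)∘(A⊗c_{H,A})∘((ρ_A∘η_A)⊗A)`; in the tensor product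
algebra `A ⊗ H` it is given by `a ↦ ρ(1) * (a ⊗ 1)`. -/
def zeta (ρ : A →ₗ[k] A ⊗[k] H) (a : A) : A ⊗[k] H :=
  ρ 1 * (a ⊗ₜ[k] (1 : H))

/-- `a` is a coinvariant element, i.e. belongs to `A_H`. -/
def IsCoinv (ρ : A →ₗ[k] A ⊗[k] H) (a : A) : Prop :=
  ρ a = zeta ρ a

/-- `(A, ρ)` is a right `H`-comodule algebra. -/
structure IsComodAlg (W : HopfData k H) (ρ : A →ₗ[k] A ⊗[k] H) : Prop where
  coassoc : ∀ a : A, (TensorProduct.assoc k A H H) ((LinearMap.rTensor H ρ) (ρ a)) =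
    (LinearMap.lTensor A W.δ) (ρ a)
  counit : ∀ a : A, (TensorProduct.rid k A) ((LinearMap.lTensor A W.ε) (ρ a)) = a
  mul_compat : ∀ a b : A, ρ (a * b) = ρ a * ρ b
  unit_coinv : (LinearMap.lTensor A (PiL W)) (ρ 1) = ρ 1

end ComodAlg

/-- For `t = Σ x ⊗ y : B ⊗ H`, the map `h ↦ Σ ε(h*y) • x`.  For
`t = ρ(1)` this is the map `e_A = (A⊗ε)∘Γ∘(H⊗η)`. -/
def eGen (W : HopfData k H) {B : Type} [AddCommGroup B] [Module k B]
    (t : B ⊗[k] H) : H →ₗ[k] B :=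
  (TensorProduct.lid k B).toLinearMap
    ∘ₗ LinearMap.rTensor B (W.ε ∘ₗ LinearMap.mul' k H)
    ∘ₗ (TensorProduct.assoc k H H B).symm.toLinearMap
    ∘ₗ LinearMap.lTensor H (TensorProduct.comm k B H).toLinearMap
    ∘ₗ (TensorProduct.mk k H (B ⊗[k] H)).flip t

/-- For `t = Σ x ⊗ y : B ⊗ H`, the map `h ↦ Σ ε(y*h) • x`.  For
`t = ρ(1)` this is the map `(A⊗(ε∘μ))∘((ρ∘η)⊗H)`. -/
def dGen (W : HopfData k H) {B : Type} [AddCommGroup B] [Module k B]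
    (t : B ⊗[k] H) : H →ₗ[k] B :=
  (TensorProduct.rid k B).toLinearMap
    ∘ₗ LinearMap.lTensor B (W.ε ∘ₗ LinearMap.mul' k H)
    ∘ₗ (TensorProduct.assoc k B H H).toLinearMap
    ∘ₗ TensorProduct.mk k (B ⊗[k] H) H t

section ComodAlg2

variable {A : Type} [Ring A] [Algebra k A]

/-- The entwining map `Γ_A^H = (A⊗μ_H)∘(c_{H,A}⊗H)∘(H⊗ρ_A)`. -/
def Γmap (ρ : A →ₗ[k] A ⊗[k] H) : H ⊗[k] A →ₗ[k] A ⊗[k] H :=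
  LinearMap.lTensor A (LinearMap.mul' k H)
    ∘ₗ (TensorProduct.assoc k A H H).toLinearMap
    ∘ₗ LinearMap.rTensor H (TensorProduct.comm k H A).toLinearMap
    ∘ₗ (TensorProduct.assoc k H A H).symm.toLinearMap
    ∘ₗ LinearMap.lTensor H ρ

/-- `f : H → A` is an integral, i.e. a morphism of right `H`-comodules. -/
def IsIntegral (W : HopfData k H) (ρ : A →ₗ[k] A ⊗[k] H) (f : H →ₗ[k] A) : Prop :=
  ∀ h : H, ρ (f h) = (LinearMap.rTensor H f) (W.δ h)

/-- `finv` is the convolution inverse of the integral `f` (conditions (c1)-(c3)). -/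
def IsConvInv (W : HopfData k H) (ρ : A →ₗ[k] A ⊗[k] H) (f finv : H →ₗ[k] A) : Prop :=
  conv k W.δ finv f = eGen W (ρ 1) ∧
  conv k W.δ f finv = dGen W (ρ 1) ∧
  conv k W.δ (conv k W.δ finv f) finv = finv

/-- `f` is a cleaving morphism (with convolution inverse `finv`) for the extension
`A_H ↪ A`, i.e. a convolution invertible integral such that `f ∧ f⁻¹` takes
values in the coinvariants. -/
def IsCleaving (W : HopfData k H) (ρ : A →ₗ[k] A ⊗[k] H) (f finv : H →ₗ[k] A) : Prop :=
  IsIntegral W ρ f ∧ IsConvInv W ρ f finv ∧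
    ∀ h : H, IsCoinv ρ (conv k W.δ f finv h)

end ComodAlg2

section ModAlg

variable {B : Type} [Ring B] [Algebra k B]

/-- `u₁ = φ ∘ (H ⊗ η_B)`. -/
def u1 (φ : H ⊗[k] B →ₗ[k] B) : H →ₗ[k] B :=
  φ ∘ₗ (TensorProduct.mk k H B).flip 1

/-- `u₂ = u₁ ∘ μ_H`. -/
def u2 (φ : H ⊗[k] B →ₗ[k] B) : H ⊗[k] H →ₗ[k] B :=
  u1 φ ∘ₗ LinearMap.mul' k H

/-- `(B, φ)` is a weak left `H`-module algebra (conditions (d1)-(d4)). -/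
def IsWeakModAlg (W : HopfData k H) (φ : H ⊗[k] B →ₗ[k] B) : Prop :=
  (∀ b : B, φ ((1 : H) ⊗ₜ[k] b) = b) ∧
  (∀ (h : H) (b c : B), φ (h ⊗ₜ[k] (b * c)) =
    LinearMap.mul' k B ((TensorProduct.map (φ ∘ₗ (TensorProduct.mk k H B).flip b)
      (φ ∘ₗ (TensorProduct.mk k H B).flip c)) (W.δ h))) ∧
  (∀ g h : H, φ ((g * h) ⊗ₜ[k] (1 : B)) = φ (g ⊗ₜ[k] φ (h ⊗ₜ[k] (1 : B)))) ∧
  (∀ (h : H) (b : B), φ (PiL W h ⊗ₜ[k] b) = φ (h ⊗ₜ[k] (1 : B)) * b)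

/-- `(B, φ)` is a left `H`-module algebra. -/
def IsModAlg (W : HopfData k H) (φ : H ⊗[k] B →ₗ[k] B) : Prop :=
  IsWeakModAlg W φ ∧
    ∀ (g h : H) (b : B), φ ((g * h) ⊗ₜ[k] b) = φ (g ⊗ₜ[k] φ (h ⊗ₜ[k] b))

/-- `(h, hinv)` is a pair of mutually convolution inverse elements in
`Reg_{φ}(H,B)`. -/
def IsRegPair (W : HopfData k H) (φ : H ⊗[k] B →ₗ[k] B) (h hinv : H →ₗ[k] B) : Prop :=
  conv k W.δ h hinv = u1 φ ∧ conv k W.δ hinv h = u1 φ ∧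
  conv k W.δ (conv k W.δ h hinv) h = h ∧
  conv k W.δ (conv k W.δ hinv h) hinv = hinv

end ModAlg

/-- The comultiplication of the tensor product coalgebra `H ⊗ H`. -/
def δ2 (W : HopfData k H) : H ⊗[k] H →ₗ[k] (H ⊗[k] H) ⊗[k] (H ⊗[k] H) :=
  (TensorProduct.tensorTensorTensorComm k H H H H).toLinearMap
    ∘ₗ TensorProduct.map W.δ W.δ

/-- The comultiplication of the tensor product coalgebra `H ⊗ (H ⊗ H)`. -/
def δ3 (W : HopfData k H) :
    H ⊗[k] (H ⊗[k] H) →ₗ[k] (H ⊗[k] (H ⊗[k] H)) ⊗[k] (H ⊗[k] (H ⊗[k] H)) :=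
  (TensorProduct.tensorTensorTensorComm k H H (H ⊗[k] H) (H ⊗[k] H)).toLinearMap
    ∘ₗ TensorProduct.map W.δ (δ2 W)

section ModAlg2

variable {B : Type} [Ring B] [Algebra k B]

/-- `(σ, σinv)` is a pair of mutually convolution inverse elements in
`Reg_{φ}(H⊗H,B)`. -/
def IsRegPair2 (W : HopfData k H) (φ : H ⊗[k] B →ₗ[k] B)
    (σ σinv : H ⊗[k] H →ₗ[k] B) : Prop :=
  conv k (δ2 W) σ σinv = u2 φ ∧ conv k (δ2 W) σinv σ = u2 φ ∧
  conv k (δ2 W) (conv k (δ2 W) σ σinv) σ = σ ∧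
  conv k (δ2 W) (conv k (δ2 W) σinv σ) σinv = σinv

/-- Condition (g1) (the twisted condition). -/
def CrossedG1 (W : HopfData k H) (φ : H ⊗[k] B →ₗ[k] B) (σ : H ⊗[k] H →ₗ[k] B) : Prop :=
  ∀ (x y : H) (b : B),
    LinearMap.mul' k B ((TensorProduct.map σ
        ((φ ∘ₗ (TensorProduct.mk k H B).flip b) ∘ₗ LinearMap.mul' k H))
      (δ2 W (x ⊗ₜ[k] y))) =
    LinearMap.mul' k B ((TensorProduct.map
        (φ ∘ₗ LinearMap.lTensor H (φ ∘ₗ (TensorProduct.mk k H B).flip b)) σ)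
      (δ2 W (x ⊗ₜ[k] y)))

/-- Condition (g2) (the cocycle condition). -/
def CrossedG2 (W : HopfData k H) (φ : H ⊗[k] B →ₗ[k] B) (σ : H ⊗[k] H →ₗ[k] B) : Prop :=
  conv k (δ3 W) (φ ∘ₗ LinearMap.lTensor H σ)
      (σ ∘ₗ LinearMap.lTensor H (LinearMap.mul' k H)) =
  conv k (δ3 W)
      ((TensorProduct.rid k B).toLinearMap ∘ₗ TensorProduct.map σ W.ε
        ∘ₗ (TensorProduct.assoc k H H H).symm.toLinearMap)
      (σ ∘ₗ LinearMap.rTensor H (LinearMap.mul' k H)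
        ∘ₗ (TensorProduct.assoc k H H H).symm.toLinearMap)

/-- Condition (g3) (the normal condition). -/
def CrossedG3 (W : HopfData k H) (φ : H ⊗[k] B →ₗ[k] B) (σ : H ⊗[k] H →ₗ[k] B) : Prop :=
  ∀ h : H, σ (h ⊗ₜ[k] (1 : H)) = u1 φ h ∧ σ ((1 : H) ⊗ₜ[k] h) = u1 φ h

/-- `(φ, σ)` is a crossed system for `H` over `B`, with `σinv` the convolution
inverse of `σ`. -/
def IsCrossedSystem (W : HopfData k H) (φ : H ⊗[k] B →ₗ[k] B)
    (σ σinv : H ⊗[k] H →ₗ[k] B) : Prop :=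
  IsWeakModAlg W φ ∧ IsRegPair2 W φ σ σinv ∧
    CrossedG1 W φ σ ∧ CrossedG2 W φ σ ∧ CrossedG3 W φ σ

/-- The condition that `h` conjugates the weak action `ϕ` into `φ`. -/
def FisEq (W : HopfData k H) (φ ϕ : H ⊗[k] B →ₗ[k] B) (h hinv : H →ₗ[k] B) : Prop :=
  ∀ (g : H) (b : B), φ (g ⊗ₜ[k] b) =
    (LinearMap.mul' k B ∘ₗ LinearMap.rTensor B (LinearMap.mul' k B))
      ((TensorProduct.map (TensorProduct.map h (ϕ ∘ₗ (TensorProduct.mk k H B).flip b)) hinv)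
        ((LinearMap.rTensor H W.δ) (W.δ g)))

/-- The condition that `h` transforms the cocycle `τ` into `σ`. -/
def SigmasEq (W : HopfData k H) (ϕ : H ⊗[k] B →ₗ[k] B)
    (σ τ : H ⊗[k] H →ₗ[k] B) (h hinv : H →ₗ[k] B) : Prop :=
  σ = conv k (δ2 W)
    (LinearMap.mul' k B ∘ₗ TensorProduct.map h ϕ
      ∘ₗ (TensorProduct.assoc k H H B).toLinearMap ∘ₗ TensorProduct.map W.δ h)
    (conv k (δ2 W) τ (hinv ∘ₗ LinearMap.mul' k H))

/-- `h` (with convolution inverse `hinv`) realizes an equivalence between the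
crossed systems `(φ, σ)` and `(ϕ, τ)`. -/
def RealizesEquiv (W : HopfData k H) (φ ϕ : H ⊗[k] B →ₗ[k] B)
    (σ τ : H ⊗[k] H →ₗ[k] B) (h hinv : H →ₗ[k] B) : Prop :=
  IsRegPair W φ h hinv ∧ IsRegPair W ϕ h hinv ∧ h 1 = 1 ∧
    FisEq W φ ϕ h hinv ∧ SigmasEq W ϕ σ τ h hinv

/-- The crossed systems `(φ, σ)` and `(ϕ, τ)` are equivalent. -/
def CrossedEquiv (W : HopfData k H) (φ ϕ : H ⊗[k] B →ₗ[k] B)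
    (σ τ : H ⊗[k] H →ₗ[k] B) : Prop :=
  u1 φ = u1 ϕ ∧ ∃ h hinv : H →ₗ[k] B, RealizesEquiv W φ ϕ σ τ h hinv

/-- The map `ψ_H^B = (φ⊗H)∘(H⊗c_{H,B})∘(δ_H⊗B)`. -/
def ψmap (W : HopfData k H) (φ : H ⊗[k] B →ₗ[k] B) : H ⊗[k] B →ₗ[k] B ⊗[k] H :=
  LinearMap.rTensor H φ
    ∘ₗ (TensorProduct.assoc k H B H).symm.toLinearMap
    ∘ₗ LinearMap.lTensor H (TensorProduct.comm k H B).toLinearMap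
    ∘ₗ (TensorProduct.assoc k H H B).toLinearMap
    ∘ₗ LinearMap.rTensor B W.δ

/-- The map `σ_H^B = (σ⊗μ_H)∘δ_{H⊗H}`. -/
def σHA (W : HopfData k H) (σ : H ⊗[k] H →ₗ[k] B) : H ⊗[k] H →ₗ[k] B ⊗[k] H :=
  TensorProduct.map σ (LinearMap.mul' k H) ∘ₗ δ2 W

/-- The idempotent `∇_{B⊗H} = (μ_B⊗H)∘(B⊗ψ_H^B)∘(B⊗H⊗η_B)`. -/
def nabla (W : HopfData k H) (φ : H ⊗[k] B →ₗ[k] B) : B ⊗[k] H →ₗ[k] B ⊗[k] H :=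
  LinearMap.rTensor H (LinearMap.mul' k B)
    ∘ₗ (TensorProduct.assoc k B B H).symm.toLinearMap
    ∘ₗ LinearMap.lTensor B (ψmap W φ)
    ∘ₗ LinearMap.lTensor B ((TensorProduct.mk k H B).flip 1)

/-- The product `(μ_B⊗H)∘(μ_B⊗σ_H^B)∘(B⊗ψ_H^B⊗H)` on `B ⊗ H`. -/
def crossmulAmb (W : HopfData k H) (φ : H ⊗[k] B →ₗ[k] B) (σ : H ⊗[k] H →ₗ[k] B) :
    (B ⊗[k] H) ⊗[k] (B ⊗[k] H) →ₗ[k] B ⊗[k] H :=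
  LinearMap.rTensor H (LinearMap.mul' k B)
    ∘ₗ (TensorProduct.assoc k B B H).symm.toLinearMap
    ∘ₗ LinearMap.lTensor B (LinearMap.rTensor H (LinearMap.mul' k B))
    ∘ₗ LinearMap.lTensor B ((TensorProduct.assoc k B B H).symm.toLinearMap)
    ∘ₗ LinearMap.lTensor B (LinearMap.lTensor B (σHA W σ))
    ∘ₗ LinearMap.lTensor B ((TensorProduct.assoc k B H H).toLinearMap)
    ∘ₗ LinearMap.lTensor B (LinearMap.rTensor H (ψmap W φ))
    ∘ₗ LinearMap.lTensor B ((TensorProduct.assoc k H B H).symm.toLinearMap)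
    ∘ₗ (TensorProduct.assoc k B H (B ⊗[k] H)).toLinearMap

end ModAlg2

section CrossProd

variable {B : Type} [Ring B] [Algebra k B]
variable {P : Type} [AddCommGroup P] [Module k P]

/-- The product of the weak crossed product `B ×_σ H`, through a splitting
`(P, p, ι)` of the idempotent `∇_{B⊗H}`. -/
def crossMul (W : HopfData k H) (φ : H ⊗[k] B →ₗ[k] B) (σ : H ⊗[k] H →ₗ[k] B)
    (p : B ⊗[k] H →ₗ[k] P) (ι : P →ₗ[k] B ⊗[k] H) : P ⊗[k] P →ₗ[k] P :=
  p ∘ₗ crossmulAmb W φ σ ∘ₗ TensorProduct.map ι ι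

/-- The unit of the weak crossed product `B ×_σ H`. -/
def crossUnit (W : HopfData k H) (φ : H ⊗[k] B →ₗ[k] B)
    (p : B ⊗[k] H →ₗ[k] P) : P :=
  p (nabla W φ ((1 : B) ⊗ₜ[k] (1 : H)))

/-- The coaction `ρ_{B×H} = (p⊗H)∘(B⊗δ_H)∘ι` of the weak crossed product. -/
def crossCoact (W : HopfData k H)
    (p : B ⊗[k] H →ₗ[k] P) (ι : P →ₗ[k] B ⊗[k] H) : P →ₗ[k] P ⊗[k] H :=
  LinearMap.rTensor H p ∘ₗ (TensorProduct.assoc k B H H).symm.toLinearMap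
    ∘ₗ LinearMap.lTensor B W.δ ∘ₗ ι

/-- The inclusion `i_{B×H} = p∘(B⊗η_H) : B → B × H`. -/
def crossInc (p : B ⊗[k] H →ₗ[k] P) : B →ₗ[k] P :=
  p ∘ₗ (TensorProduct.mk k B H).flip 1

/-- The analogue of `ζ` for an abstract module `P` with product `m`:
`ζ(x) = t · (x ⊗ 1)` where `t` plays the role of `ρ(1)`. -/
def zetaGen (m : P ⊗[k] P →ₗ[k] P) (t : P ⊗[k] H) (x : P) : P ⊗[k] H :=
  (TensorProduct.map m (LinearMap.mul' k H))
    ((TensorProduct.tensorTensorTensorComm k P H P H) (t ⊗ₜ[k] (x ⊗ₜ[k] (1 : H))))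

end CrossProd

section Induced

variable {D P : Type} [AddCommGroup D] [Module k D] [AddCommGroup P] [Module k P]

/-- The map `(P⊗P)⊗P → P`, `(x⊗y)⊗z ↦ x·(z·y)`. -/
def mulSwizG (m : P ⊗[k] P →ₗ[k] P) : (P ⊗[k] P) ⊗[k] P →ₗ[k] P :=
  m ∘ₗ LinearMap.lTensor P (m ∘ₗ (TensorProduct.comm k P P).toLinearMap)
    ∘ₗ (TensorProduct.assoc k P P P).toLinearMap

/-- The ambient weak action `μ∘(P⊗(μ∘c))∘(((f⊗f⁻¹)∘δ_H)⊗j) : H ⊗ D → P`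
induced by a cleaving morphism `f`. -/
def phiAmb (W : HopfData k H) (m : P ⊗[k] P →ₗ[k] P) (f finv : H →ₗ[k] P)
    (j : D →ₗ[k] P) : H ⊗[k] D →ₗ[k] P :=
  mulSwizG m ∘ₗ TensorProduct.map ((TensorProduct.map f finv) ∘ₗ W.δ) j

/-- The ambient cocycle `(μ∘(f⊗f)) ∧ (f⁻¹∘μ_H) : H ⊗ H → P` induced by a
cleaving morphism `f`. -/
def sigmaAmb (W : HopfData k H) (m : P ⊗[k] P →ₗ[k] P) (f finv : H →ₗ[k] P) :
    H ⊗[k] H →ₗ[k] P :=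
  convG k (δ2 W) m (m ∘ₗ TensorProduct.map f f) (finv ∘ₗ LinearMap.mul' k H)

end Induced

section Pres

variable {A D : Type} [Ring A] [Algebra k A] [Ring D] [Algebra k D]

/-- `j : D → A` presents `D` as the subalgebra of coinvariants of `A`. -/
def IsCoinvPres (ρ : A →ₗ[k] A ⊗[k] H) (j : D →ₐ[k] A) : Prop :=
  Function.Injective j ∧ ∀ a : A, IsCoinv ρ a ↔ a ∈ Set.range j

end Pres

section Convolution

variable {C D A E : Type} [AddCommGroup C] [Module k C] [AddCommGroup D] [Module k D]
  [Ring A] [Algebra k A] [Ring E] [Algebra k E]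

/-- Associativity of convolution over a coassociative comultiplication, with the convolution
products written out. -/
theorem mul_map_assoc {M : Type} [AddCommMonoid M] [Module k M] {δM : M →ₗ[k] M ⊗[k] M}
    (hM : ∀ c, TensorProduct.assoc k M M M (LinearMap.rTensor M δM (δM c)) =
      LinearMap.lTensor M δM (δM c)) (f g l : M →ₗ[k] A) :
    LinearMap.mul' k A ∘ₗ
        TensorProduct.map (LinearMap.mul' k A ∘ₗ TensorProduct.map f g ∘ₗ δM) l ∘ₗ δM =
      LinearMap.mul' k A ∘ₗ
        TensorProduct.map f (LinearMap.mul' k A ∘ₗ TensorProduct.map g l ∘ₗ δM) ∘ₗ δM := by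
  ext c
  let m : M ⊗[k] (M ⊗[k] M) →ₗ[k] A := LinearMap.mul' k A ∘ₗ TensorProduct.map f
    (LinearMap.mul' k A ∘ₗ TensorProduct.map g l)
  have h₁ : LinearMap.mul' k A ∘ₗ
      TensorProduct.map (LinearMap.mul' k A ∘ₗ TensorProduct.map f g ∘ₗ δM) l =
      m ∘ₗ (TensorProduct.assoc k M M M).toLinearMap ∘ₗ LinearMap.rTensor M δM := by
    refine TensorProduct.ext' fun x y => ?_
    simp only [LinearMap.comp_apply, TensorProduct.map_tmul, LinearMap.rTensor_tmul,
      LinearEquiv.coe_coe, LinearMap.mul'_apply]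
    induction δM x using TensorProduct.induction_on with
    | zero => simp
    | tmul a b => simp [m, mul_assoc]
    | add a b ha hb => simp only [map_add, add_mul, TensorProduct.add_tmul, ha, hb]
  have h₂ : LinearMap.mul' k A ∘ₗ
      TensorProduct.map f (LinearMap.mul' k A ∘ₗ TensorProduct.map g l ∘ₗ δM) =
      m ∘ₗ LinearMap.lTensor M δM := by
    refine TensorProduct.ext' fun x y => ?_
    simp [m]
  have h₃ := LinearMap.congr_fun h₁ (δM c)
  have h₄ := LinearMap.congr_fun h₂ (δM c)
  simp only [LinearMap.comp_apply, LinearEquiv.coe_coe, hM] at h₃ h₄ ⊢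
  exact h₃.trans h₄.symm

/-- Convolution over a coassociative comultiplication is associative. -/
theorem conv_assoc {δC : C →ₗ[k] C ⊗[k] C}
    (hC : ∀ c, TensorProduct.assoc k C C C (LinearMap.rTensor C δC (δC c)) =
      LinearMap.lTensor C δC (δC c)) (f g l : C →ₗ[k] A) :
    conv k δC (conv k δC f g) l = conv k δC f (conv k δC g l) :=
  mul_map_assoc hC f g l

/-- Precomposition with a comultiplicative map preserves convolution. -/
theorem conv_comp {δC : C →ₗ[k] C ⊗[k] C} {δD : D →ₗ[k] D ⊗[k] D} {q : C →ₗ[k] D}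
    (hq : δD ∘ₗ q = TensorProduct.map q q ∘ₗ δC) (f g : D →ₗ[k] A) :
    conv k δD f g ∘ₗ q = conv k δC (f ∘ₗ q) (g ∘ₗ q) := by
  simp only [conv, convG, LinearMap.comp_assoc, hq, TensorProduct.map_comp]

/-- Postcomposition with an algebra morphism preserves convolution. -/
theorem algHom_comp_conv (j : A →ₐ[k] E) (δC : C →ₗ[k] C ⊗[k] C) (f g : C →ₗ[k] A) :
    j.toLinearMap ∘ₗ conv k δC f g = conv k δC (j.toLinearMap ∘ₗ f) (j.toLinearMap ∘ₗ g) := by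
  have h₁ : j.toLinearMap ∘ₗ LinearMap.mul' k A ∘ₗ TensorProduct.map f g =
      LinearMap.mul' k E ∘ₗ TensorProduct.map (j.toLinearMap ∘ₗ f) (j.toLinearMap ∘ₗ g) :=
    TensorProduct.ext' fun x y => by simp
  simp only [conv, convG, ← LinearMap.comp_assoc] at h₁ ⊢
  rw [h₁]

end Convolution

section TensorSquare

variable {A : Type} [Ring A] [Algebra k A]

theorem δ2_coassoc {W : HopfData k H} (hW : IsWeakHopf W) (c : H ⊗[k] H) :
    TensorProduct.assoc k (H ⊗[k] H) (H ⊗[k] H) (H ⊗[k] H)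
        (LinearMap.rTensor (H ⊗[k] H) (δ2 W) (δ2 W c)) =
      LinearMap.lTensor (H ⊗[k] H) (δ2 W) (δ2 W c) := by
  let s : (H ⊗[k] (H ⊗[k] H)) ⊗[k] (H ⊗[k] (H ⊗[k] H)) →ₗ[k]
      (H ⊗[k] H) ⊗[k] ((H ⊗[k] H) ⊗[k] (H ⊗[k] H)) :=
    LinearMap.lTensor _ (TensorProduct.tensorTensorTensorComm k H H H H).toLinearMap ∘ₗ
      (TensorProduct.tensorTensorTensorComm k H (H ⊗[k] H) H (H ⊗[k] H)).toLinearMap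
  have h₁ : ∀ t u : H ⊗[k] H, TensorProduct.assoc k (H ⊗[k] H) (H ⊗[k] H) (H ⊗[k] H)
      (LinearMap.rTensor (H ⊗[k] H) (δ2 W)
        (TensorProduct.tensorTensorTensorComm k H H H H (t ⊗ₜ u))) =
      s (TensorProduct.assoc k H H H (LinearMap.rTensor H W.δ t) ⊗ₜ
        TensorProduct.assoc k H H H (LinearMap.rTensor H W.δ u)) := by
    intro t u
    induction t using TensorProduct.induction_on with
    | zero => simp
    | add a b ha hb => simp only [map_add, TensorProduct.add_tmul, ha, hb]
    | tmul x x' =>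
      induction u using TensorProduct.induction_on with
      | zero => simp
      | add a b ha hb => simp only [map_add, TensorProduct.tmul_add, ha, hb]
      | tmul y y' =>
        simp only [TensorProduct.tensorTensorTensorComm_tmul, LinearMap.rTensor_tmul, δ2,
          LinearMap.comp_apply, TensorProduct.map_tmul, LinearEquiv.coe_coe]
        induction W.δ x using TensorProduct.induction_on with
        | zero => simp
        | add a b ha hb => simp only [map_add, TensorProduct.add_tmul, ha, hb]
        | tmul a a' =>
          induction W.δ y using TensorProduct.induction_on with
          | zero => simp
          | add a b ha hb =>
            simp only [map_add, TensorProduct.add_tmul, TensorProduct.tmul_add, ha, hb]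
          | tmul b b' => simp [s]
  have h₂ : ∀ t u : H ⊗[k] H, LinearMap.lTensor (H ⊗[k] H) (δ2 W)
        (TensorProduct.tensorTensorTensorComm k H H H H (t ⊗ₜ u)) =
      s (LinearMap.lTensor H W.δ t ⊗ₜ LinearMap.lTensor H W.δ u) := by
    intro t u
    induction t using TensorProduct.induction_on with
    | zero => simp
    | add a b ha hb => simp only [map_add, TensorProduct.add_tmul, ha, hb]
    | tmul x x' =>
      induction u using TensorProduct.induction_on with
      | zero => simp
      | add a b ha hb => simp only [map_add, TensorProduct.tmul_add, ha, hb]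
      | tmul y y' => simp [s, δ2]
  induction c using TensorProduct.induction_on with
  | zero => simp
  | add a b ha hb => simp only [map_add, ha, hb]
  | tmul x y =>
    have h₃ : δ2 W (x ⊗ₜ[k] y) =
      TensorProduct.tensorTensorTensorComm k H H H H (W.δ x ⊗ₜ W.δ y) := rfl
    rw [h₃, h₁, h₂, hW.coassoc, hW.coassoc]

theorem conv_δ2_assoc {W : HopfData k H} (hW : IsWeakHopf W) (f g l : H ⊗[k] H →ₗ[k] A) :
    conv k (δ2 W) (conv k (δ2 W) f g) l = conv k (δ2 W) f (conv k (δ2 W) g l) :=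
  mul_map_assoc (δ2_coassoc hW) f g l

theorem δ_comp_mul {W : HopfData k H} (hW : IsWeakHopf W) :
    W.δ ∘ₗ LinearMap.mul' k H =
      TensorProduct.map (LinearMap.mul' k H) (LinearMap.mul' k H) ∘ₗ δ2 W := by
  refine TensorProduct.ext' fun x y => ?_
  simp only [LinearMap.comp_apply, LinearMap.mul'_apply, hW.a1, δ2, TensorProduct.map_tmul,
    LinearEquiv.coe_coe]
  induction W.δ x using TensorProduct.induction_on with
  | zero => simp
  | add a b ha hb => simp only [map_add, TensorProduct.add_tmul, add_mul, ha, hb]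
  | tmul a a' =>
    induction W.δ y using TensorProduct.induction_on with
    | zero => simp
    | add a b ha hb => simp only [map_add, TensorProduct.tmul_add, mul_add, ha, hb]
    | tmul b b' => simp

/-- The coalgebra projection `H ⊗ ε : H ⊗ H → H`. -/
def fstProj (W : HopfData k H) : H ⊗[k] H →ₗ[k] H :=
  (TensorProduct.rid k H).toLinearMap ∘ₗ LinearMap.lTensor H W.ε

/-- Convolving on the left with a map that factors through `fstProj`. -/
theorem conv_fstProj_tmul {W : HopfData k H} (hW : IsWeakHopf W) (f : H →ₗ[k] A)
    (g : H ⊗[k] H →ₗ[k] A) (x y : H) :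
    conv k (δ2 W) (f ∘ₗ fstProj W) g (x ⊗ₜ y) =
      conv k W.δ f (g ∘ₗ (TensorProduct.mk k H H).flip y) x := by
  have h₁ : ∀ t u : H ⊗[k] H, LinearMap.mul' k A (TensorProduct.map (f ∘ₗ fstProj W) g
      (TensorProduct.tensorTensorTensorComm k H H H H (t ⊗ₜ u))) =
      LinearMap.mul' k A (TensorProduct.map f (g ∘ₗ (TensorProduct.mk k H H).flip
        (TensorProduct.lid k H (LinearMap.rTensor H W.ε u))) t) := by
    intro t u
    induction t using TensorProduct.induction_on with
    | zero => simp
    | add a b ha hb => simp only [map_add, TensorProduct.add_tmul, ha, hb]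
    | tmul x x' =>
      induction u using TensorProduct.induction_on with
      | zero => simp
      | add a b ha hb =>
        simp only [map_add, TensorProduct.tmul_add, ha, hb, TensorProduct.map_tmul,
          LinearMap.comp_apply, LinearMap.add_apply, LinearMap.mul'_apply]
      | tmul y y' => simp [fstProj]
  have h₂ := h₁ (W.δ x) (W.δ y)
  rw [hW.counit_left] at h₂
  exact h₂

theorem δ_comp_fstProj {W : HopfData k H} (hW : IsWeakHopf W) :
    W.δ ∘ₗ fstProj W = TensorProduct.map (fstProj W) (fstProj W) ∘ₗ δ2 W := by
  have h₁ : ∀ t u : H ⊗[k] H, TensorProduct.map (fstProj W) (fstProj W)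
      (TensorProduct.tensorTensorTensorComm k H H H H (t ⊗ₜ u)) =
      W.ε (TensorProduct.lid k H (LinearMap.rTensor H W.ε u)) • t := by
    intro t u
    induction t using TensorProduct.induction_on with
    | zero => simp
    | add a b ha hb => simp only [map_add, TensorProduct.add_tmul, smul_add, ha, hb]
    | tmul x x' =>
      induction u using TensorProduct.induction_on with
      | zero => simp
      | add a b ha hb => simp only [map_add, TensorProduct.tmul_add, ha, hb, add_smul]
      | tmul y y' => simp [fstProj, TensorProduct.smul_tmul', TensorProduct.tmul_smul, smul_smul,
          mul_comm]
  refine TensorProduct.ext' fun x y => ?_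
  have h₂ := h₁ (W.δ x) (W.δ y)
  rw [hW.counit_left] at h₂
  simpa [fstProj, δ2] using h₂.symm

end TensorSquare

section Twist

variable {A : Type} [Ring A] [Algebra k A]

/-- The map `A ⊗ H → A ⊗ H`, `a ⊗ g ↦ a f(g₁) ⊗ g₂`. -/
def twist (W : HopfData k H) (f : H →ₗ[k] A) : A ⊗[k] H →ₗ[k] A ⊗[k] H :=
  LinearMap.rTensor H (LinearMap.mul' k A)
    ∘ₗ (TensorProduct.assoc k A A H).symm.toLinearMap
    ∘ₗ LinearMap.lTensor A (LinearMap.rTensor H f)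
    ∘ₗ LinearMap.lTensor A W.δ

variable (k H A) in
/-- The inclusion `a ↦ a ⊗ 1`. -/
def inclA : A →ₐ[k] A ⊗[k] H := Algebra.TensorProduct.includeLeft

variable (k H A) in
/-- The inclusion `g ↦ 1 ⊗ g`. -/
def inclH : H →ₗ[k] A ⊗[k] H :=
  (Algebra.TensorProduct.includeRight : H →ₐ[k] A ⊗[k] H).toLinearMap

theorem twist_tmul (W : HopfData k H) (f : H →ₗ[k] A) (a : A) (g : H) :
    twist W f (a ⊗ₜ g) =
      inclA k H A a * conv k W.δ ((inclA k H A).toLinearMap ∘ₗ f) (inclH k H A) g := by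
  simp only [twist, conv, convG, LinearMap.comp_apply, LinearMap.lTensor_tmul]
  induction W.δ g using TensorProduct.induction_on with
  | zero => simp
  | add a b ha hb => simp only [map_add, TensorProduct.tmul_add, mul_add, ha, hb]
  | tmul b b' => simp [inclA, inclH]

/-- A map out of `A ⊗ H` that is left `A`-linear can be moved inside a convolution. -/
theorem leftLinear_comp_conv {C : Type} [AddCommGroup C] [Module k C]
    {K : A ⊗[k] H →ₗ[k] A ⊗[k] H} {κ : H →ₗ[k] A ⊗[k] H}
    (hK : ∀ a x, K (a ⊗ₜ x) = inclA k H A a * κ x) (δC : C →ₗ[k] C ⊗[k] C)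
    (f : C →ₗ[k] A) (q : C →ₗ[k] H) :
    K ∘ₗ conv k δC ((inclA k H A).toLinearMap ∘ₗ f) (inclH k H A ∘ₗ q) =
      conv k δC ((inclA k H A).toLinearMap ∘ₗ f) (κ ∘ₗ q) := by
  have h₁ : K ∘ₗ LinearMap.mul' k (A ⊗[k] H) ∘ₗ
        TensorProduct.map ((inclA k H A).toLinearMap ∘ₗ f) (inclH k H A ∘ₗ q) =
      LinearMap.mul' k (A ⊗[k] H) ∘ₗ
        TensorProduct.map ((inclA k H A).toLinearMap ∘ₗ f) (κ ∘ₗ q) := by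
    refine TensorProduct.ext' fun x y => ?_
    have h₂ := hK (f x) (q y)
    simpa [inclA, inclH] using h₂
  simp only [conv, convG, ← LinearMap.comp_assoc] at h₁ ⊢
  rw [h₁]

theorem leftLinear_mul {K : A ⊗[k] H →ₗ[k] A ⊗[k] H} {κ : H →ₗ[k] A ⊗[k] H}
    (hK : ∀ a x, K (a ⊗ₜ x) = inclA k H A a * κ x) (a : A) (t : A ⊗[k] H) :
    K (inclA k H A a * t) = inclA k H A a * K t := by
  induction t using TensorProduct.induction_on with
  | zero => simp
  | add a b ha hb => simp only [map_add, mul_add, ha, hb]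
  | tmul b x =>
    have h₁ : inclA k H A a * b ⊗ₜ[k] x = (a * b) ⊗ₜ[k] x := by simp [inclA]
    rw [h₁, hK, hK, map_mul, mul_assoc]

theorem leftLinear_twist {K : A ⊗[k] H →ₗ[k] A ⊗[k] H} {κ : H →ₗ[k] A ⊗[k] H}
    (hK : ∀ a x, K (a ⊗ₜ x) = inclA k H A a * κ x) (W : HopfData k H) (f : H →ₗ[k] A)
    (a : A) (g : H) :
    K (twist W f (a ⊗ₜ g)) =
      inclA k H A a * conv k W.δ ((inclA k H A).toLinearMap ∘ₗ f) κ g := by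
  rw [twist_tmul, leftLinear_mul hK]
  exact congrArg _ (LinearMap.congr_fun (leftLinear_comp_conv hK W.δ f LinearMap.id) g)

theorem twist_comp_twist {W : HopfData k H} (hW : IsWeakHopf W) (f g : H →ₗ[k] A) :
    twist W f ∘ₗ twist W g = twist W (conv k W.δ g f) := by
  refine TensorProduct.ext' fun a x => ?_
  rw [LinearMap.comp_apply, leftLinear_twist (twist_tmul W f), twist_tmul, algHom_comp_conv,
    conv_assoc hW.coassoc]

theorem nabla_eq_twist (W : HopfData k H) (φ : H ⊗[k] A →ₗ[k] A) :
    nabla W φ = twist W (u1 φ) := by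
  refine TensorProduct.ext' fun a x => ?_
  simp only [nabla, twist, ψmap, u1, LinearMap.comp_apply, LinearMap.lTensor_tmul,
    LinearMap.flip_apply, TensorProduct.mk_apply, LinearMap.rTensor_tmul]
  induction W.δ x using TensorProduct.induction_on with
  | zero => simp
  | add a b ha hb => simp only [map_add, TensorProduct.add_tmul, TensorProduct.tmul_add, ha, hb]
  | tmul b b' => simp

/-- `twist` is colinear for the coaction `A ⊗ δ_H`. -/
theorem twist_colinear {W : HopfData k H} (hW : IsWeakHopf W) (f : H →ₗ[k] A) :
    (TensorProduct.assoc k A H H).symm.toLinearMap ∘ₗ LinearMap.lTensor A W.δ ∘ₗ twist W f =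
      LinearMap.rTensor H (twist W f) ∘ₗ (TensorProduct.assoc k A H H).symm.toLinearMap ∘ₗ
        LinearMap.lTensor A W.δ := by
  refine TensorProduct.ext' fun a x => ?_
  let m : H ⊗[k] (H ⊗[k] H) →ₗ[k] (A ⊗[k] H) ⊗[k] H :=
    (TensorProduct.assoc k A H H).symm.toLinearMap ∘ₗ
      LinearMap.rTensor (H ⊗[k] H) (LinearMap.mulLeft k a ∘ₗ f)
  have h₁ : ∀ t : H ⊗[k] H, (TensorProduct.assoc k A H H).symm (LinearMap.lTensor A W.δ
      (LinearMap.rTensor H (LinearMap.mul' k A) ((TensorProduct.assoc k A A H).symm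
        (a ⊗ₜ LinearMap.rTensor H f t)))) = m (LinearMap.lTensor H W.δ t) := by
    intro t
    induction t using TensorProduct.induction_on with
    | zero => simp
    | add a b ha hb => simp only [map_add, TensorProduct.tmul_add, ha, hb]
    | tmul b b' => simp [m]
  have h₂ : ∀ t : H ⊗[k] H, LinearMap.rTensor H (twist W f)
      ((TensorProduct.assoc k A H H).symm (a ⊗ₜ t)) =
      m (TensorProduct.assoc k H H H (LinearMap.rTensor H W.δ t)) := by
    intro t
    induction t using TensorProduct.induction_on with
    | zero => simp
    | add a b ha hb => simp only [map_add, TensorProduct.tmul_add, ha, hb]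
    | tmul b b' =>
      simp only [TensorProduct.assoc_symm_tmul, LinearMap.rTensor_tmul, twist,
        LinearMap.comp_apply, LinearMap.lTensor_tmul]
      induction W.δ b using TensorProduct.induction_on with
      | zero => simp
      | add a b ha hb => simp only [map_add, TensorProduct.tmul_add, TensorProduct.add_tmul, ha, hb]
      | tmul c c' => simp [m]
  have h₃ := h₂ (W.δ x)
  rw [hW.coassoc, ← h₁] at h₃
  simpa [twist] using h₃.symm

end Twist

section Coinvariants

variable {A : Type} [Ring A] [Algebra k A]

/-- `δ(Π^L(x)) = Π^L(x) 1₁ ⊗ 1₂`. -/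
theorem δ_PiL {W : HopfData k H} (hW : IsWeakHopf W) (x : H) :
    W.δ (PiL W x) = (PiL W x ⊗ₜ[k] 1) * W.δ 1 := by
  let e : H →ₗ[k] k := W.ε ∘ₗ LinearMap.mulRight k x
  have h₁ : ∀ t : H ⊗[k] H, W.δ ((TensorProduct.rid k H).toLinearMap
      (LinearMap.lTensor H (W.ε ∘ₗ LinearMap.mul' k H) (TensorProduct.assoc k H H H
        (LinearMap.rTensor H (TensorProduct.comm k H H).toLinearMap (t ⊗ₜ x))))) =
      TensorProduct.lid k (H ⊗[k] H) (LinearMap.rTensor (H ⊗[k] H) e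
        (LinearMap.lTensor H W.δ t)) := by
    intro t
    induction t using TensorProduct.induction_on with
    | zero => simp
    | add a b ha hb => simp only [map_add, TensorProduct.add_tmul, ha, hb]
    | tmul b b' => simp [e]
  have h₂ : ∀ t u : H ⊗[k] H, TensorProduct.lid k (H ⊗[k] H) (LinearMap.rTensor (H ⊗[k] H) e
      ((TensorProduct.map LinearMap.id
        (Algebra.TensorProduct.includeLeft : H →ₐ[k] H ⊗[k] H).toLinearMap) t *
      (Algebra.TensorProduct.includeRight : (H ⊗[k] H) →ₐ[k] H ⊗[k] (H ⊗[k] H)).toLinearMap u)) =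
      ((TensorProduct.rid k H).toLinearMap
      (LinearMap.lTensor H (W.ε ∘ₗ LinearMap.mul' k H) (TensorProduct.assoc k H H H
        (LinearMap.rTensor H (TensorProduct.comm k H H).toLinearMap (t ⊗ₜ x)))) ⊗ₜ 1) * u := by
    intro t u
    induction t using TensorProduct.induction_on with
    | zero => simp
    | add a b ha hb => simp only [map_add, TensorProduct.add_tmul, add_mul, ha, hb]
    | tmul b b' => simp [e, ← TensorProduct.smul_tmul']
  have h₃ := h₁ (W.δ 1)
  rw [← hW.coassoc, hW.a3, h₂] at h₃
  exact h₃

/-- `1₁ ⊗ Π^L(1₂) = 1₁ ⊗ 1₂`. -/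
theorem lTensor_PiL_δ_one {W : HopfData k H} (hW : IsWeakHopf W) :
    LinearMap.lTensor H (PiL W) (W.δ 1) = W.δ 1 := by
  let r : H ⊗[k] (H ⊗[k] H) →ₗ[k] H ⊗[k] H :=
    LinearMap.lTensor H ((TensorProduct.lid k H).toLinearMap ∘ₗ LinearMap.rTensor H W.ε)
  have h₁ : ∀ t u : H ⊗[k] H, LinearMap.lTensor H ((TensorProduct.rid k H).toLinearMap
      ∘ₗ LinearMap.lTensor H (W.ε ∘ₗ LinearMap.mul' k H)
      ∘ₗ (TensorProduct.assoc k H H H).toLinearMap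
      ∘ₗ LinearMap.rTensor H (TensorProduct.comm k H H).toLinearMap
      ∘ₗ TensorProduct.mk k (H ⊗[k] H) H u) t =
      r ((Algebra.TensorProduct.includeRight : (H ⊗[k] H) →ₐ[k] H ⊗[k] (H ⊗[k] H)).toLinearMap u *
      (TensorProduct.map LinearMap.id
        (Algebra.TensorProduct.includeLeft : H →ₐ[k] H ⊗[k] H).toLinearMap) t) := by
    intro t u
    induction t using TensorProduct.induction_on with
    | zero => simp
    | add a b ha hb => simp only [map_add, mul_add, ha, hb]
    | tmul b b' =>
      induction u using TensorProduct.induction_on with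
      | zero => simp
      | add a b ha hb =>
        simp only [LinearMap.lTensor_tmul, LinearMap.comp_apply, TensorProduct.mk_apply] at ha hb ⊢
        simp only [map_add, TensorProduct.add_tmul, TensorProduct.tmul_add, add_mul, ha, hb]
      | tmul c c' => simp [r]
  have h₂ : ∀ t : H ⊗[k] H, r (LinearMap.lTensor H W.δ t) = t := by
    intro t
    induction t using TensorProduct.induction_on with
    | zero => simp
    | add a b ha hb => simp only [map_add, ha, hb]
    | tmul b b' => simp [r, hW.counit_left]
  refine (h₁ (W.δ 1) (W.δ 1)).trans ?_
  rw [← hW.a3', hW.coassoc, h₂]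

/-- A normalized map absorbing `u₁` on the left agrees with `u₁` on the image of `Π^L`. -/
theorem apply_PiL_eq_u1 {W : HopfData k H} (hW : IsWeakHopf W) {φ : H ⊗[k] A →ₗ[k] A}
    (hφ : IsWeakModAlg W φ) {f : H →ₗ[k] A} (hf : conv k W.δ (u1 φ) f = f) (h1 : f 1 = 1)
    (x : H) : f (PiL W x) = u1 φ (PiL W x) := by
  obtain ⟨-, -, d3, d4⟩ := hφ
  have h₁ : ∀ t : H ⊗[k] H, LinearMap.mul' k A (TensorProduct.map (u1 φ) f
      ((PiL W x ⊗ₜ[k] 1) * t)) =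
      φ (x ⊗ₜ 1) * LinearMap.mul' k A (TensorProduct.map (u1 φ) f t) := by
    intro t
    induction t using TensorProduct.induction_on with
    | zero => simp
    | add a b ha hb => simp only [map_add, mul_add, ha, hb]
    | tmul b b' => simp [u1, d3, d4, mul_assoc]
  have h₂ : LinearMap.mul' k A (TensorProduct.map (u1 φ) f (W.δ 1)) = 1 :=
    (LinearMap.congr_fun hf 1).trans h1
  have h₃ := (LinearMap.congr_fun hf (PiL W x)).symm
  simp only [conv, convG, LinearMap.comp_apply, δ_PiL hW, h₁, h₂] at h₃
  simpa [u1, d4] using h₃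

theorem rTensor_δ_one_eq_u1 {W : HopfData k H} (hW : IsWeakHopf W) (hcc : Cocomm W)
    {φ : H ⊗[k] A →ₗ[k] A} (hφ : IsWeakModAlg W φ) {f : H →ₗ[k] A}
    (hf : conv k W.δ (u1 φ) f = f) (h1 : f 1 = 1) :
    LinearMap.rTensor H f (W.δ 1) = LinearMap.rTensor H (u1 φ) (W.δ 1) := by
  have h₁ : LinearMap.rTensor H (PiL W) (W.δ 1) = W.δ 1 := by
    conv_lhs => rw [← hcc 1]
    rw [LinearMap.rTensor, TensorProduct.map_comm]
    exact (congrArg _ (lTensor_PiL_δ_one hW)).trans (hcc 1)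
  rw [← h₁, ← LinearMap.rTensor_comp_apply, ← LinearMap.rTensor_comp_apply]
  congr 2
  exact LinearMap.ext (apply_PiL_eq_u1 hW hφ hf h1)

theorem twist_tmul_one {W : HopfData k H} (hW : IsWeakHopf W) (hcc : Cocomm W)
    {φ : H ⊗[k] A →ₗ[k] A} (hφ : IsWeakModAlg W φ) {f : H →ₗ[k] A}
    (hf : conv k W.δ (u1 φ) f = f) (h1 : f 1 = 1) (a : A) :
    twist W f (a ⊗ₜ 1) = nabla W φ (a ⊗ₜ 1) := by
  simp only [nabla_eq_twist, twist, LinearMap.comp_apply, LinearMap.lTensor_tmul,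
    rTensor_δ_one_eq_u1 hW hcc hφ hf h1]

end Coinvariants

section Multiplicativity

variable {A : Type} [Ring A] [Algebra k A]

theorem σHA_eq_conv (W : HopfData k H) (σ : H ⊗[k] H →ₗ[k] A) :
    σHA W σ = conv k (δ2 W) ((inclA k H A).toLinearMap ∘ₗ σ)
      (inclH k H A ∘ₗ LinearMap.mul' k H) := by
  have h₁ : TensorProduct.map σ (LinearMap.mul' k H) =
      LinearMap.mul' k (A ⊗[k] H) ∘ₗ TensorProduct.map ((inclA k H A).toLinearMap ∘ₗ σ)
        (inclH k H A ∘ₗ LinearMap.mul' k H) :=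
    TensorProduct.ext' fun x y => by simp [inclA, inclH]
  rw [σHA, h₁, conv, convG, LinearMap.comp_assoc]

theorem crossmulAmb_tmul {W : HopfData k H} (φ : H ⊗[k] A →ₗ[k] A)
    (σ : H ⊗[k] H →ₗ[k] A) (a b : A) (x y : H) :
    crossmulAmb W φ σ ((a ⊗ₜ x) ⊗ₜ (b ⊗ₜ y)) = inclA k H A a *
      conv k W.δ ((inclA k H A).toLinearMap ∘ₗ φ ∘ₗ (TensorProduct.mk k H A).flip b)
        (σHA W σ ∘ₗ (TensorProduct.mk k H H).flip y) x := by
  have h₁ : ∀ (a : A) (t : A ⊗[k] H), LinearMap.rTensor H (LinearMap.mul' k A)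
      ((TensorProduct.assoc k A A H).symm (a ⊗ₜ t)) = inclA k H A a * t := by
    intro a t
    induction t using TensorProduct.induction_on with
    | zero => simp
    | add a b ha hb => simp only [map_add, TensorProduct.tmul_add, mul_add, ha, hb]
    | tmul b b' => simp [inclA]
  simp only [crossmulAmb, LinearMap.comp_apply, LinearEquiv.coe_coe, TensorProduct.assoc_tmul,
    LinearMap.lTensor_tmul, h₁, TensorProduct.assoc_symm_tmul, LinearMap.rTensor_tmul, ψmap,
    conv, convG]
  congr 1
  induction W.δ x using TensorProduct.induction_on with
  | zero => simp
  | add a b ha hb => simp only [map_add, TensorProduct.add_tmul, ha, hb]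
  | tmul c c' => simp [h₁]

theorem crossmulAmb_tmul_twist {W : HopfData k H} (φ : H ⊗[k] A →ₗ[k] A)
    (σ : H ⊗[k] H →ₗ[k] A) (f : H →ₗ[k] A) (a b : A) (x y : H) :
    crossmulAmb W φ σ ((a ⊗ₜ x) ⊗ₜ twist W f (b ⊗ₜ y)) = inclA k H A a *
      conv k (δ2 W) ((inclA k H A).toLinearMap ∘ₗ φ ∘ₗ
        LinearMap.lTensor H (LinearMap.mulLeft k b ∘ₗ f)) (σHA W σ) (x ⊗ₜ y) := by
  have h₁ : ∀ t : H ⊗[k] H, crossmulAmb W φ σ ((a ⊗ₜ x) ⊗ₜ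
      LinearMap.rTensor H (LinearMap.mul' k A) ((TensorProduct.assoc k A A H).symm
        (b ⊗ₜ LinearMap.rTensor H f t))) = inclA k H A a *
      LinearMap.mul' k (A ⊗[k] H) (TensorProduct.map ((inclA k H A).toLinearMap ∘ₗ φ ∘ₗ
        LinearMap.lTensor H (LinearMap.mulLeft k b ∘ₗ f)) (σHA W σ)
        (TensorProduct.tensorTensorTensorComm k H H H H (W.δ x ⊗ₜ t))) := by
    intro t
    induction t using TensorProduct.induction_on with
    | zero => simp
    | add a b ha hb => simp only [map_add, TensorProduct.tmul_add, mul_add, ha, hb]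
    | tmul c c' =>
      simp only [LinearMap.rTensor_tmul, TensorProduct.assoc_symm_tmul, LinearMap.mul'_apply,
        crossmulAmb_tmul, conv, convG, LinearMap.comp_apply]
      congr 1
      induction W.δ x using TensorProduct.induction_on with
      | zero => simp
      | add a b ha hb => simp only [map_add, TensorProduct.add_tmul, ha, hb]
      | tmul d d' => simp
  simpa [twist, conv, convG, δ2] using h₁ (W.δ y)

/-- Comparison of the `A`-valued parts of the products of equivalent crossed systems. -/
theorem conv_action_cocycle {W : HopfData k H} (hW : IsWeakHopf W)
    {φ ϕ : H ⊗[k] A →ₗ[k] A} {α β βinv : H ⊗[k] H →ₗ[k] A} {h hinv : H →ₗ[k] A}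
    (hβ : IsCrossedSystem W ϕ β βinv) (hequiv : RealizesEquiv W φ ϕ α β h hinv)
    (b : A) :
    conv k (δ2 W) ((φ ∘ₗ (TensorProduct.mk k H A).flip b) ∘ₗ fstProj W)
      (conv k (δ2 W) α (h ∘ₗ LinearMap.mul' k H)) =
      conv k (δ2 W) (h ∘ₗ fstProj W) (conv k (δ2 W)
        (ϕ ∘ₗ LinearMap.lTensor H (LinearMap.mulLeft k b ∘ₗ h)) β) := by
  obtain ⟨-, ⟨-, hinv_h, -, -⟩, -, hφ, hα⟩ := hequiv
  obtain ⟨⟨-, d2, -, -⟩, ⟨-, βinv_β, ββ, -⟩, -⟩ := hβ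
  have conv_lTensor (b : A) (f : H →ₗ[k] A) :
      conv k (δ2 W) ((ϕ ∘ₗ (TensorProduct.mk k H A).flip b) ∘ₗ fstProj W)
        (ϕ ∘ₗ LinearMap.lTensor H f) =
      ϕ ∘ₗ LinearMap.lTensor H (LinearMap.mulLeft k b ∘ₗ f) := by
    refine TensorProduct.ext' fun x y => ?_
    rw [conv_fstProj_tmul hW]
    simp only [LinearMap.comp_apply, LinearMap.lTensor_tmul, LinearMap.mulLeft_apply, d2]
    rfl
  have hφ' (b : A) : φ ∘ₗ (TensorProduct.mk k H A).flip b =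
      conv k W.δ h (conv k W.δ (ϕ ∘ₗ (TensorProduct.mk k H A).flip b) hinv) := by
    rw [← conv_assoc hW.coassoc]
    ext x
    refine (hφ x b).trans ?_
    simp only [conv, convG, LinearMap.comp_apply]
    induction W.δ x using TensorProduct.induction_on with
    | zero => simp
    | add a b ha hb => simp only [map_add, ha, hb]
    | tmul d d' =>
      simp only [LinearMap.rTensor_tmul, TensorProduct.map_tmul, LinearMap.mul'_apply,
        LinearMap.comp_apply]
  have hα' : α = conv k (δ2 W) (conv k (δ2 W) (h ∘ₗ fstProj W) (ϕ ∘ₗ LinearMap.lTensor H h))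
      (conv k (δ2 W) β (hinv ∘ₗ LinearMap.mul' k H)) := by
    rw [SigmasEq] at hα
    rw [hα]
    congr 1
    refine TensorProduct.ext' fun x y => ?_
    rw [conv_fstProj_tmul hW]
    simp only [conv, convG, LinearMap.comp_apply, TensorProduct.map_tmul]
    induction W.δ x using TensorProduct.induction_on with
    | zero => simp
    | add a b ha hb => simp only [map_add, TensorProduct.add_tmul, ha, hb]
    | tmul d d' => simp
  have hβu : conv k (δ2 W) β (conv k (δ2 W) (hinv ∘ₗ LinearMap.mul' k H)
      (h ∘ₗ LinearMap.mul' k H)) = β := by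
    rw [← conv_comp (δ_comp_mul hW), hinv_h]
    conv_rhs => rw [← ββ, conv_δ2_assoc hW, βinv_β]
    rfl
  have hu1 : conv k (δ2 W) (hinv ∘ₗ fstProj W) (conv k (δ2 W) (h ∘ₗ fstProj W)
      (ϕ ∘ₗ LinearMap.lTensor H h)) = ϕ ∘ₗ LinearMap.lTensor H h := by
    rw [← conv_δ2_assoc hW, ← conv_comp (δ_comp_fstProj hW), hinv_h, u1, conv_lTensor]
    congr 2
    ext x
    simp
  rw [hφ', hα', conv_comp (δ_comp_fstProj hW), conv_comp (δ_comp_fstProj hW)]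
  simp only [conv_δ2_assoc hW]
  rw [hβu, ← conv_lTensor]
  conv_rhs => rw [← hu1]
  simp only [conv_δ2_assoc hW]

/-- `twist W h` turns the product of one crossed system into that of the other. -/
theorem twist_crossmulAmb {W : HopfData k H} (hW : IsWeakHopf W)
    {φ ϕ : H ⊗[k] A →ₗ[k] A} {α β βinv : H ⊗[k] H →ₗ[k] A} {h hinv : H →ₗ[k] A}
    (hβ : IsCrossedSystem W ϕ β βinv) (hequiv : RealizesEquiv W φ ϕ α β h hinv)
    (s t : A ⊗[k] H) :
    twist W h (crossmulAmb W φ α (s ⊗ₜ t)) =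
      crossmulAmb W ϕ β (twist W h s ⊗ₜ twist W h t) := by
  induction s using TensorProduct.induction_on with
  | zero => simp
  | add a b ha hb => simp only [map_add, TensorProduct.add_tmul, ha, hb]
  | tmul a x =>
    induction t using TensorProduct.induction_on with
    | zero => simp
    | add a b ha hb => simp only [map_add, TensorProduct.tmul_add, ha, hb]
    | tmul b y =>
      rw [crossmulAmb_tmul, leftLinear_mul (twist_tmul W h)]
      have hR := leftLinear_twist (K := crossmulAmb W ϕ β ∘ₗ
          (TensorProduct.mk k (A ⊗[k] H) (A ⊗[k] H)).flip (twist W h (b ⊗ₜ y)))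
        (κ := conv k (δ2 W) ((inclA k H A).toLinearMap ∘ₗ ϕ ∘ₗ
          LinearMap.lTensor H (LinearMap.mulLeft k b ∘ₗ h)) (σHA W β) ∘ₗ
            (TensorProduct.mk k H H).flip y)
        (fun a x => crossmulAmb_tmul_twist ϕ β h a b x y) W h a x
      refine Eq.trans ?_ hR.symm
      congr 1
      rw [← conv_fstProj_tmul hW, ← conv_fstProj_tmul hW, σHA_eq_conv, σHA_eq_conv]
      have hk := congrArg (fun F : H ⊗[k] H →ₗ[k] A => conv k (δ2 W) ((inclA k H A).toLinearMap ∘ₗ F)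
        (inclH k H A ∘ₗ LinearMap.mul' k H) (x ⊗ₜ y)) (conv_action_cocycle hW hβ hequiv b)
      simp only [algHom_comp_conv] at hk
      have hL := LinearMap.congr_fun (leftLinear_comp_conv (twist_tmul W h) (δ2 W)
        (conv k (δ2 W) ((φ ∘ₗ (TensorProduct.mk k H A).flip b) ∘ₗ fstProj W) α)
        (LinearMap.mul' k H)) (x ⊗ₜ y)
      rw [conv_comp (δ_comp_mul hW), algHom_comp_conv] at hL
      simp only [conv_δ2_assoc hW, LinearMap.comp_assoc] at hL hk ⊢
      exact hL.trans hk

end Multiplicativity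

/-- If `(φ, α)` and `(ϕ, β)` are equivalent crossed systems
for a cocommutative weak Hopf algebra `H` over `A`, realized by
`h ∈ Reg_{φ}(H,A) ∩ Reg_{ϕ}(H,A)`, then the associated `H`-cleft extensions
`A ↪ A×_αH` and `A ↪ A×_βH` are equivalent; explicitly
`T = p∘(μ_A⊗H)∘(A⊗h⊗H)∘(A⊗δ_H)∘ι` is an isomorphism of right `H`-comodule
algebras with `T∘i_{A×_αH} = i_{A×_βH}`. -/
theorem statement12 {k H A P : Type} [CommRing k] [Ring H] [Algebra k H]
    [Ring A] [Algebra k A] [AddCommGroup P] [Module k P]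
    (W : HopfData k H) (hW : IsWeakHopf W) (hcc : Cocomm W)
    (φ ϕ : H ⊗[k] A →ₗ[k] A) (α αinv β βinv : H ⊗[k] H →ₗ[k] A)
    (hα : IsCrossedSystem W φ α αinv) (hβ : IsCrossedSystem W ϕ β βinv)
    (hu : u1 φ = u1 ϕ) (h hinv : H →ₗ[k] A)
    (hequiv : RealizesEquiv W φ ϕ α β h hinv)
    (p : A ⊗[k] H →ₗ[k] P) (ι : P →ₗ[k] A ⊗[k] H)
    (hsplit : ι ∘ₗ p = nabla W φ) (hretr : p ∘ₗ ι = LinearMap.id) :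
    ∀ T : P →ₗ[k] P,
      T = p ∘ₗ LinearMap.rTensor H (LinearMap.mul' k A)
        ∘ₗ (TensorProduct.assoc k A A H).symm.toLinearMap
        ∘ₗ LinearMap.lTensor A (LinearMap.rTensor H h)
        ∘ₗ LinearMap.lTensor A W.δ ∘ₗ ι →
      -- `T` is multiplicative and unital from `A×_αH` to `A×_βH`:
      (∀ x y : P, T (crossMul W φ α p ι (x ⊗ₜ[k] y)) =
          crossMul W ϕ β p ι (T x ⊗ₜ[k] T y)) ∧
      T (crossUnit W φ p) = crossUnit W ϕ p ∧
      -- `T` is a morphism of right `H`-comodules: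
      (∀ x : P, crossCoact W p ι (T x) =
          (LinearMap.rTensor H T) (crossCoact W p ι x)) ∧
      -- `T` is an isomorphism compatible with the inclusions of `A`:
      Function.Bijective T ∧
      (∀ a : A, T (crossInc p a) = crossInc p a) := by
  obtain ⟨hreg, -, h1, -, -⟩ := id hequiv
  obtain ⟨h_hinv, hinv_h, hhh, -⟩ := hreg
  have u_h : conv k W.δ (u1 φ) h = h := by rw [← h_hinv, hhh]
  have h_u : conv k W.δ h (u1 φ) = h := by rw [← hinv_h, ← conv_assoc hW.coassoc, hhh]
  have hιp (t : A ⊗[k] H) : ι (p t) = twist W (u1 φ) t := by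
    rw [← nabla_eq_twist, ← hsplit]; rfl
  have hpι (x : P) : p (ι x) = x := LinearMap.congr_fun hretr x
  have twist_twist (f g : H →ₗ[k] A) (t : A ⊗[k] H) :
      twist W f (twist W g t) = twist W (conv k W.δ g f) t :=
    LinearMap.congr_fun (twist_comp_twist hW f g) t
  have hp (t : A ⊗[k] H) : p (twist W (u1 φ) t) = p t := by rw [← hιp, hpι]
  intro T hT
  have hTx (x : P) : T x = p (twist W h (ι x)) := by rw [hT]; rfl
  have hTp (t : A ⊗[k] H) : T (p t) = p (twist W h t) := by
    rw [hTx, hιp, twist_twist, u_h]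
  have hιT (x : P) : ι (T x) = twist W h (ι x) := by rw [hTx, hιp, twist_twist, h_u]
  have hTone (a : A) : T (p (a ⊗ₜ 1)) = p (a ⊗ₜ 1) := by
    rw [hTp, twist_tmul_one hW hcc hα.1 u_h h1, nabla_eq_twist, hp]
  refine ⟨fun x y => ?_, ?_, fun x => ?_, ?_, hTone⟩
  · simp only [crossMul, LinearMap.comp_apply, TensorProduct.map_tmul]
    rw [hTp, twist_crossmulAmb hW hβ hequiv, hιT, hιT]
  · simp only [crossUnit, nabla_eq_twist, ← hu, hp]
    exact hTone 1
  · have hcol := LinearMap.congr_fun (twist_colinear hW h) (ι x)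
    have hTp' : T ∘ₗ p = p ∘ₗ twist W h := LinearMap.ext hTp
    simp only [crossCoact, LinearMap.comp_apply] at hcol ⊢
    rw [hιT, hcol, ← LinearMap.rTensor_comp_apply, ← LinearMap.rTensor_comp_apply, hTp']
  · have hleft (x : P) : p (twist W hinv (ι (T x))) = x := by
      rw [hιT, twist_twist, h_hinv, hp, hpι]
    have hright (x : P) : T (p (twist W hinv (ι x))) = x := by
      rw [hTp, twist_twist, hinv_h, hp, hpι]
    exact Function.bijective_iff_has_inverse.mpr
      ⟨fun x => p (twist W hinv (ι x)), hleft, hright⟩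

end WHA

end
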